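/- Let k and a be integers with 1 ≤ a ≤ k, k even, and a odd, and let q be a complex number with |q| < 1. Then ∑_{n_1,…,n_{k−1} ≥ 0} q^{N_1² + ⋯ + N_{k−1}² + n_1 + n_3 + ⋯ + n_{a−2} + N_a + N_{a+1} + ⋯ + N_{k−1}} / ((q²;q²)_{n_1} (q²;q²)_{n_2} ⋯ (q²;q²)_{n_{k−1}}) = (−q²; q²)_∞ (q^{a+1}, q^{2k+1−a}, q^{2k+2}; q^{2k+2})_∞ / (q²; q²)_∞, where n_1 + n_3 + ⋯ + n_{a−2} runs over odd subscripts up to a−2 (this list being empty if a = 1), and the sum converges absolutely. -/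

import Mathlib

open Finset

/-- Finite q-Pochhammer symbol `(x;q)_n`. -/
noncomputable def qPoch (q x : ℂ) (n : ℕ) : ℂ :=
  ∏ j ∈ Finset.range n, (1 - x * q ^ j)

/-- Infinite q-Pochhammer symbol `(x;q)_∞`. -/
noncomputable def qPochInf (q x : ℂ) : ℂ :=
  ∏' j : ℕ, (1 - x * q ^ j)

/-- `Nsum m n i = n_i + n_{i+1} + ⋯ + n_m` (1-based), where `n : Fin m → ℕ` lists
`n_1, …, n_m`; in particular `Nsum m n i = 0` for `i > m`. -/
def Nsum (m : ℕ) (n : Fin m → ℕ) (i : ℕ) : ℕ :=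
  ∑ j : Fin m, if i ≤ (j : ℕ) + 1 then n j else 0

/-- Summand of the multisum for `\overline{W}_{k,a}` with `k` even and `a` odd:
exponent `N_1² + ⋯ + N_{k-1}² + n_1 + n_3 + ⋯ + n_{a-2} + N_a + N_{a+1} + ⋯ + N_{k-1}`
(note `n_i = N_i - N_{i+1}`), denominator `(q²;q²)_{n_1} ⋯ (q²;q²)_{n_{k-1}}`. -/
noncomputable def owTerm (k a : ℕ) (q : ℂ) (n : Fin (k - 1) → ℕ) : ℂ :=
  q ^ ((∑ i ∈ Finset.Icc 1 (k - 1), (Nsum (k - 1) n i) ^ 2) +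
        (∑ i ∈ (Finset.Icc 1 (a - 2)).filter (fun i => i % 2 = 1),
          (Nsum (k - 1) n i - Nsum (k - 1) n (i + 1))) +
        ∑ i ∈ Finset.Icc a (k - 1), Nsum (k - 1) n i) /
    ∏ j : Fin (k - 1), qPoch (q ^ 2) (q ^ 2) (n j)

/-! ### Finite `q`-Pochhammer symbols -/

theorem qPoch_succ (q x : ℂ) (n : ℕ) : qPoch q x (n + 1) = qPoch q x n * (1 - x * q ^ n) :=
  Finset.prod_range_succ _ _

theorem qPoch_add (q x : ℂ) (m n : ℕ) :
    qPoch q x (m + n) = qPoch q x m * qPoch q (x * q ^ m) n := by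
  simp only [qPoch, Finset.prod_range_add, pow_add, mul_assoc]

theorem qPoch_succ' (q x : ℂ) (n : ℕ) : qPoch q x (n + 1) = (1 - x) * qPoch q (x * q) n := by
  rw [add_comm, qPoch_add]
  simp [qPoch]

theorem one_sub_ne_zero_of_norm_lt {x : ℂ} (hx : ‖x‖ < 1) : 1 - x ≠ 0 := by
  intro h
  rw [← sub_eq_zero.mp h] at hx
  simp at hx

theorem norm_mul_pow_lt {q x : ℂ} (hq : ‖q‖ < 1) (hx : ‖x‖ < 1) (n : ℕ) : ‖x * q ^ n‖ < 1 := by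
  rw [norm_mul, norm_pow]
  exact mul_lt_one_of_nonneg_of_lt_one_left (norm_nonneg _) hx
    (pow_le_one₀ (norm_nonneg _) hq.le)

theorem one_sub_pow_succ_ne_zero {q : ℂ} (hq : ‖q‖ < 1) (n : ℕ) : 1 - q ^ (n + 1) ≠ 0 := by
  rw [pow_succ']
  exact one_sub_ne_zero_of_norm_lt (norm_mul_pow_lt hq hq n)

theorem qPoch_ne_zero {q x : ℂ} (hq : ‖q‖ < 1) (hx : ‖x‖ < 1) (n : ℕ) : qPoch q x n ≠ 0 :=
  Finset.prod_ne_zero_iff.mpr fun j _ => one_sub_ne_zero_of_norm_lt (norm_mul_pow_lt hq hx j)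

/-- The reciprocal `1 / (q;q)_n`. -/
noncomputable def qPochInv (q : ℂ) (n : ℕ) : ℂ := (qPoch q q n)⁻¹

@[simp]
theorem qPochInv_zero (q : ℂ) : qPochInv q 0 = 1 := by simp [qPochInv, qPoch]

theorem one_sub_mul_qPochInv_succ {q : ℂ} (hq : ‖q‖ < 1) (n : ℕ) :
    (1 - q ^ (n + 1)) * qPochInv q (n + 1) = qPochInv q n := by
  have h := one_sub_pow_succ_ne_zero hq n
  have h2 := qPoch_ne_zero hq hq n
  rw [qPochInv, qPochInv, qPoch_succ, ← pow_succ']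
  field_simp

theorem qPochInv_eq_mul_qPoch {q : ℂ} (hq : ‖q‖ < 1) (m n : ℕ) :
    qPochInv q m = qPochInv q (m + n) * qPoch q (q ^ (m + 1)) n := by
  have h := qPoch_ne_zero hq hq (m + n)
  rw [qPochInv, qPochInv]
  rw [qPoch_add, ← pow_succ'] at h ⊢
  have h1 := left_ne_zero_of_mul h
  have h2 := right_ne_zero_of_mul h
  field_simp

/-! ### The `q`-Chu–Vandermonde sum -/

theorem choose_two_succ (n : ℕ) : (n + 1).choose 2 = n.choose 2 + n := by
  rw [Nat.choose_succ_succ' n 1, Nat.choose_one_right, add_comm]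

theorem choose_two_add (s i : ℕ) :
    (s + i).choose 2 = s.choose 2 + i.choose 2 + s * i := by
  induction i with
  | zero => simp
  | succ i ih => rw [← add_assoc, choose_two_succ, choose_two_succ, ih]; ring

theorem sq_eq_choose_two_add (s : ℕ) : s ^ 2 = (s + 1).choose 2 + s.choose 2 := by
  induction s with
  | zero => rfl
  | succ s ih =>
    rw [choose_two_succ s] at ih
    rw [choose_two_succ (s + 1), choose_two_succ s]
    linarith

theorem sum_antidiagonal_succ_one_sub_pow {q : ℂ} (hq : ‖q‖ < 1) (f : ℕ → ℕ → ℂ) (N : ℕ) :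
    (1 - q ^ (N + 1)) * ∑ p ∈ antidiagonal (N + 1), f p.1 p.2 * qPochInv q p.1 * qPochInv q p.2 =
      ∑ p ∈ antidiagonal N,
        (q ^ p.1 * f p.1 (p.2 + 1) + f (p.1 + 1) p.2) * qPochInv q p.1 * qPochInv q p.2 := by
  have split : (1 - q ^ (N + 1)) *
      ∑ p ∈ antidiagonal (N + 1), f p.1 p.2 * qPochInv q p.1 * qPochInv q p.2 =
      (∑ p ∈ antidiagonal (N + 1),
        q ^ p.1 * (1 - q ^ p.2) * (f p.1 p.2 * qPochInv q p.1 * qPochInv q p.2)) +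
      ∑ p ∈ antidiagonal (N + 1),
        (1 - q ^ p.1) * (f p.1 p.2 * qPochInv q p.1 * qPochInv q p.2) := by
    rw [Finset.mul_sum, ← Finset.sum_add_distrib]
    refine Finset.sum_congr rfl fun p hp => ?_
    rw [← mem_antidiagonal.mp hp, pow_add]
    ring
  rw [split, Finset.Nat.sum_antidiagonal_succ', Finset.Nat.sum_antidiagonal_succ]
  simp only [pow_zero, sub_self, mul_zero, zero_mul, zero_add]
  rw [← Finset.sum_add_distrib]
  refine Finset.sum_congr rfl fun p _ => ?_
  rw [← one_sub_mul_qPochInv_succ hq p.1, ← one_sub_mul_qPochInv_succ hq p.2]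
  ring

/-- The `q`-Chu–Vandermonde sum, with the denominators depending on `b * d` cleared. -/
theorem sum_qChuVandermonde {q : ℂ} (hq : ‖q‖ < 1) (b d : ℂ) (N : ℕ) :
    ∑ p ∈ antidiagonal N, (-d) ^ p.1 * q ^ (p.1.choose 2) * qPoch q b p.1 *
        qPoch q (b * d * q ^ p.1) p.2 * qPochInv q p.1 * qPochInv q p.2 =
      qPoch q d N * qPochInv q N := by
  induction N generalizing d with
  | zero => simp [qPoch]
  | succ N ih =>
    refine mul_left_cancel₀ (one_sub_pow_succ_ne_zero hq N) ?_
    rw [sum_antidiagonal_succ_one_sub_pow hq (fun i j => (-d) ^ i * q ^ (i.choose 2) *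
      qPoch q b i * qPoch q (b * d * q ^ i) j), mul_left_comm, one_sub_mul_qPochInv_succ hq,
      qPoch_succ', mul_assoc, ← ih (d * q), Finset.mul_sum]
    refine Finset.sum_congr rfl fun p _ => ?_
    rw [qPoch_succ' q _ p.2, qPoch_succ q b p.1, choose_two_succ]
    have e1 : b * d * q ^ p.1 * q = b * d * q ^ (p.1 + 1) := by ring
    have e2 : b * (d * q) * q ^ p.1 = b * d * q ^ (p.1 + 1) := by ring
    rw [e1, e2]
    generalize qPoch q (b * d * q ^ (p.1 + 1)) p.2 = X
    rw [neg_mul_eq_neg_mul, mul_pow]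
    ring

/-! ### Bailey pairs -/

theorem sum_antidiagonal_assoc (f : ℕ → ℕ → ℕ → ℂ) (n : ℕ) :
    ∑ p ∈ antidiagonal n, ∑ r ∈ antidiagonal p.1, f r.1 r.2 p.2 =
      ∑ p ∈ antidiagonal n, ∑ r ∈ antidiagonal p.2, f p.1 r.1 r.2 := by
  simp only [Finset.sum_sigma']
  refine Finset.sum_nbij' (fun x => ⟨(x.2.1, x.2.2 + x.1.2), (x.2.2, x.1.2)⟩)
    (fun x => ⟨(x.1.1 + x.2.1, x.2.2), (x.1.1, x.2.1)⟩) ?_ ?_ ?_ ?_ fun _ _ => rfl <;>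
  · rintro ⟨⟨i, j⟩, ⟨k, l⟩⟩ h
    simp only [mem_sigma, HasAntidiagonal.mem_antidiagonal] at h ⊢
    obtain ⟨h1, h2⟩ := h
    subst h2
    subst h1
    simp [add_assoc]

/-- The operator `f ↦ ∑_{i ≤ n} w_i f_i / (q;q)_{n-i}`. -/
noncomputable def chainStep (q : ℂ) (w f : ℕ → ℂ) (n : ℕ) : ℂ :=
  ∑ p ∈ antidiagonal n, w p.1 * f p.1 * qPochInv q p.2

/-- The sum `∑_{s ≤ n} α_s / ((q;q)_{n-s} (q;q)_{n+s+e})`. -/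
noncomputable def baileySum (q : ℂ) (e : ℕ) (α : ℕ → ℂ) (n : ℕ) : ℂ :=
  ∑ p ∈ antidiagonal n, α p.1 * qPochInv q p.2 * qPochInv q (2 * p.1 + p.2 + e)

theorem chainStep_baileySum (q : ℂ) (e : ℕ) (w g h l α : ℕ → ℂ)
    (H : ∀ s N, ∑ p ∈ antidiagonal N, w (s + p.1) * g (s + p.1) * qPochInv q p.1 *
      qPochInv q (2 * s + p.1 + e) * qPochInv q p.2 =
        l s * h (s + N) * qPochInv q N * qPochInv q (2 * s + N + e)) (n : ℕ) :
    chainStep q w (fun i => g i * baileySum q e α i) n =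
      h n * baileySum q e (fun s => l s * α s) n := by
  have key := sum_antidiagonal_assoc (fun s t j => α s * (w (s + t) * g (s + t) * qPochInv q t *
      qPochInv q (2 * s + t + e) * qPochInv q j)) n
  simp only [← Finset.mul_sum, H] at key
  rw [chainStep, baileySum, Finset.mul_sum]
  convert key using 1
  · refine Finset.sum_congr rfl fun p _ => ?_
    rw [baileySum, Finset.mul_sum, Finset.mul_sum, Finset.sum_mul]
    refine Finset.sum_congr rfl fun r hr => ?_
    rw [mem_antidiagonal.mp hr]
    ring
  · refine Finset.sum_congr rfl fun p hp => ?_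
    rw [mem_antidiagonal.mp hp]
    ring

theorem bailey_kernel {q : ℂ} (hq : ‖q‖ < 1) (e s : ℕ) (b d : ℂ)
    (hbd : b * d = q ^ (2 * s + e + 1)) (N : ℕ) :
    ∑ p ∈ antidiagonal N, (-d) ^ p.1 * q ^ (p.1.choose 2) * qPoch q b p.1 * qPochInv q p.1 *
      qPochInv q (2 * s + p.1 + e) * qPochInv q p.2 =
        qPoch q d N * qPochInv q N * qPochInv q (2 * s + N + e) := by
  rw [← sum_qChuVandermonde hq b d N, Finset.sum_mul]
  refine Finset.sum_congr rfl fun p hp => ?_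
  rw [qPochInv_eq_mul_qPoch hq (2 * s + p.1 + e) p.2, hbd, ← pow_add, ← mem_antidiagonal.mp hp]
  have e1 : 2 * s + p.1 + e + p.2 = 2 * s + (p.1 + p.2) + e := by ring
  have e2 : 2 * s + e + 1 + p.1 = 2 * s + p.1 + e + 1 := by ring
  rw [e1, e2]
  ring

/-- The step with weights `q^{i(i+1)/2}` on Bailey pairs relative to `q`. -/
theorem chainStep_choose_succ_baileySum_one {q : ℂ} (hq : ‖q‖ < 1) (α : ℕ → ℂ) (n : ℕ) :
    chainStep q (fun i => q ^ (i + 1).choose 2) (fun i => qPoch q (-q) i * baileySum q 1 α i) n =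
      qPoch q (-q) n * baileySum q 1 (fun s => q ^ (s + 1).choose 2 * α s) n := by
  refine chainStep_baileySum q 1 _ _ _ _ α (fun s N => ?_) n
  have hk := bailey_kernel hq 1 s (-q * q ^ s) (-q * q ^ s) (by ring) N
  rw [qPoch_add, mul_assoc, mul_assoc, mul_assoc, ← mul_assoc _ _ (qPochInv q _), ← hk,
    Finset.mul_sum, Finset.mul_sum]
  refine Finset.sum_congr rfl fun p _ => ?_
  rw [qPoch_add, choose_two_succ, choose_two_succ, choose_two_add]
  ring

theorem one_add_pow_ne_zero {q : ℂ} (hq : ‖q‖ < 1) (n : ℕ) : 1 + q ^ n ≠ 0 := by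
  rcases n with _ | n
  · norm_num
  · have := one_sub_ne_zero_of_norm_lt (x := -q ^ (n + 1)) (by
      rw [norm_neg, pow_succ']; exact norm_mul_pow_lt hq hq n)
    simpa using this

theorem one_add_mul_qPoch_neg (q : ℂ) (s i : ℕ) :
    (1 + q ^ (s + i)) * (qPoch q (-q) s * qPoch q (-q ^ s) i) =
      (1 + q ^ s) * qPoch q (-q) (s + i) := by
  have h : qPoch q (-q ^ s) (i + 1) = qPoch q (-q ^ s) i * (1 + q ^ (s + i)) := by
    rw [qPoch_succ]; ring
  have h' : qPoch q (-q ^ s) (i + 1) = (1 + q ^ s) * qPoch q (-q * q ^ s) i := by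
    rw [qPoch_succ', neg_mul, neg_mul, ← pow_succ, ← pow_succ']; ring
  rw [qPoch_add]
  linear_combination qPoch q (-q) s * (h' - h)

/-- The step with weights `q^{i(i-1)/2}` on Bailey pairs relative to `1`. -/
theorem chainStep_choose_baileySum_zero {q : ℂ} (hq : ‖q‖ < 1) (α : ℕ → ℂ) (n : ℕ) :
    chainStep q (fun i => q ^ i.choose 2) (fun i => qPoch q (-q) i * baileySum q 0 α i) n =
      qPoch q (-q) n / (1 + q ^ n) *
        baileySum q 0 (fun s => (1 + q ^ s) * q ^ s.choose 2 * α s) n := by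
  refine chainStep_baileySum q 0 _ _ (fun n => qPoch q (-q) n / (1 + q ^ n)) _ α (fun s N => ?_) n
  have hk := bailey_kernel hq 0 s (-q * q ^ s) (-q ^ s) (by ring) N
  have h1 : (1 + q ^ s) * (qPoch q (-q) (s + N) / (1 + q ^ (s + N))) =
      qPoch q (-q) s * qPoch q (-q ^ s) N := by
    rw [← mul_div_assoc, ← one_add_mul_qPoch_neg, mul_div_cancel_left₀ _ (one_add_pow_ne_zero hq _)]
  rw [mul_right_comm (1 + q ^ s), h1, mul_comm _ (q ^ s.choose 2), ← mul_assoc, mul_assoc, mul_assoc,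
    ← mul_assoc _ _ (qPochInv q _), ← hk, Finset.mul_sum]
  refine Finset.sum_congr rfl fun p _ => ?_
  rw [qPoch_add, choose_two_add]
  ring

/-- The step with weights `q^{i(i+1)/2}` on Bailey pairs relative to `1`. -/
theorem chainStep_choose_succ_baileySum_zero {q : ℂ} (hq : ‖q‖ < 1) (α : ℕ → ℂ) (n : ℕ) :
    chainStep q (fun i => q ^ (i + 1).choose 2)
        (fun i => qPoch q (-q) i / (1 + q ^ i) * baileySum q 0 α i) n =
      qPoch q (-q) n * baileySum q 0 (fun s => q ^ (s + 1).choose 2 / (1 + q ^ s) * α s) n := by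
  refine chainStep_baileySum q 0 _ (fun n => qPoch q (-q) n / (1 + q ^ n)) _ _ α (fun s N => ?_) n
  have hk := bailey_kernel hq 0 s (-q ^ s) (-q * q ^ s) (by ring) N
  have h0 := one_add_pow_ne_zero hq s
  have h1 (i : ℕ) : qPoch q (-q) (s + i) / (1 + q ^ (s + i)) =
      qPoch q (-q) s * qPoch q (-q ^ s) i / (1 + q ^ s) := by
    rw [div_eq_div_iff (one_add_pow_ne_zero hq _) h0]
    linear_combination -one_add_mul_qPoch_neg q s i
  rw [qPoch_add, mul_assoc, mul_assoc, mul_assoc, ← mul_assoc _ _ (qPochInv q _), ← hk,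
    Finset.mul_sum, Finset.mul_sum]
  refine Finset.sum_congr rfl fun p _ => ?_
  rw [h1, choose_two_succ, choose_two_succ, choose_two_add]
  ring

theorem sum_unit_bailey_partial {q : ℂ} (hq : ‖q‖ < 1) (M t : ℕ) :
    (1 - q ^ (M + t)) * ∑ s ∈ range M, (-1) ^ s * q ^ s.choose 2 * (1 - q ^ (2 * s + 1)) *
        qPochInv q (M + t - s) * qPochInv q (M + t + s + 1) =
      -((-1) ^ M * q ^ M.choose 2 * (1 - q ^ M) * qPochInv q t * qPochInv q (2 * M + t)) := by
  induction M generalizing t with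
  | zero => simp
  | succ M ih =>
    have h := ih (t + 1)
    rw [← add_assoc, add_right_comm M t 1] at h
    rw [Finset.sum_range_succ, mul_add, h, choose_two_succ,
      show M + 1 + t - M = t + 1 by omega, show M + 1 + t + M + 1 = 2 * M + t + 1 + 1 by ring,
      show 2 * (M + 1) + t = 2 * M + t + 1 + 1 by ring, ← one_sub_mul_qPochInv_succ hq t,
      show 2 * M + (t + 1) = 2 * M + t + 1 by ring, ← one_sub_mul_qPochInv_succ hq (2 * M + t + 1)]
    ring

/-- The unit Bailey pair relative to `q`. -/
theorem baileySum_one_unit {q : ℂ} (hq : ‖q‖ < 1) (n : ℕ) :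
    baileySum q 1 (fun s => (-1) ^ s * q ^ s.choose 2 * (1 - q ^ (2 * s + 1))) n =
      if n = 0 then 1 else 0 := by
  rcases n with _ | n
  · have := one_sub_mul_qPochInv_succ hq 0
    simpa [baileySum] using this
  rw [if_neg n.succ_ne_zero]
  refine (mul_eq_zero.mp ?_).resolve_left (one_sub_pow_succ_ne_zero hq n)
  have h := sum_unit_bailey_partial hq (n + 1) 0
  simp only [add_zero] at h
  rw [baileySum, Finset.Nat.sum_antidiagonal_eq_sum_range_succ (fun s t =>
    (-1) ^ s * q ^ s.choose 2 * (1 - q ^ (2 * s + 1)) * qPochInv q t * qPochInv q (2 * s + t + 1)),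
    Finset.sum_range_succ, mul_add]
  have e : ∀ s ∈ range (n + 1), (-1 : ℂ) ^ s * q ^ s.choose 2 * (1 - q ^ (2 * s + 1)) *
      qPochInv q (n + 1 - s) * qPochInv q (2 * s + (n + 1 - s) + 1) =
      (-1) ^ s * q ^ s.choose 2 * (1 - q ^ (2 * s + 1)) *
        qPochInv q (n + 1 - s) * qPochInv q (n + 1 + s + 1) := fun s hs => by
    have := mem_range.mp hs
    rw [show 2 * s + (n + 1 - s) = n + 1 + s by omega]
  rw [Finset.sum_congr rfl e, h, Nat.sub_self, add_zero,
    ← one_sub_mul_qPochInv_succ hq (2 * (n + 1))]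
  ring

/-- Passing from a Bailey pair relative to `q` to one relative to `1`. -/
theorem baileySum_one_eq_baileySum_zero {q : ℂ} (hq : ‖q‖ < 1) (A α : ℕ → ℂ) (h0 : α 0 = A 0)
    (hs : ∀ s, α (s + 1) = A (s + 1) - q ^ (2 * s + 1) * A s) (n : ℕ) :
    baileySum q 1 (fun s => A s * (1 - q ^ (2 * s + 1))) n = baileySum q 0 α n := by
  have split : baileySum q 1 (fun s => A s * (1 - q ^ (2 * s + 1))) n =
      (∑ p ∈ antidiagonal n, A p.1 * qPochInv q p.2 * qPochInv q (2 * p.1 + p.2)) -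
      ∑ p ∈ antidiagonal n, q ^ (2 * p.1 + 1) * A p.1 * ((1 - q ^ p.2) * qPochInv q p.2) *
        qPochInv q (2 * p.1 + p.2 + 1) := by
    rw [baileySum, ← Finset.sum_sub_distrib]
    refine Finset.sum_congr rfl fun p _ => ?_
    rw [← one_sub_mul_qPochInv_succ hq (2 * p.1 + p.2)]
    ring
  rw [split, baileySum]
  rcases n with _ | n
  · simp [h0]
  rw [Finset.Nat.sum_antidiagonal_succ, Finset.Nat.sum_antidiagonal_succ',
    Finset.Nat.sum_antidiagonal_succ, h0]
  simp only [pow_zero, sub_self, mul_zero, zero_mul, zero_add, add_zero, add_sub_assoc,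
    ← Finset.sum_sub_distrib]
  congr 1
  refine Finset.sum_congr rfl fun p _ => ?_
  rw [one_sub_mul_qPochInv_succ hq, hs,
    show 2 * p.1 + (p.2 + 1) + 1 = 2 * (p.1 + 1) + p.2 by ring]
  ring

/-! ### Nested sums -/

/-- The nested sums obtained by applying `chainStep` with weights `w_{m-1}, …, w_0` to
`1 / (q;q)_n`. -/
noncomputable def nestedSum (q : ℂ) : (ℕ → ℕ → ℂ) → ℕ → ℕ → ℂ
  | _, 0 => qPochInv q
  | w, m + 1 => chainStep q (w 0) (nestedSum q (fun i => w (i + 1)) m)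

/-- The weights `q^{N(N-1)/2}` at the first `r` odd places and `q^{N(N+1)/2}` elsewhere. -/
noncomputable def parityWeight (q : ℂ) (r i N : ℕ) : ℂ :=
  if i % 2 = 1 ∧ i < 2 * r then q ^ N.choose 2 else q ^ (N + 1).choose 2

theorem nestedSum_parityWeight_zero {q : ℂ} (hq : ‖q‖ < 1) (m : ℕ) :
    nestedSum q (parityWeight q 0) m = fun n => qPoch q (-q) n * baileySum q 1
      (fun s => (-1) ^ s * q ^ s ^ 2 * q ^ (m * (s + 1).choose 2) * (1 - q ^ (2 * s + 1))) n := by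
  induction m with
  | zero =>
    funext n
    have h := chainStep_choose_succ_baileySum_one hq
      (fun s => (-1) ^ s * q ^ s.choose 2 * (1 - q ^ (2 * s + 1))) n
    simp only [baileySum_one_unit hq] at h
    rw [nestedSum]
    convert h using 1
    · rw [chainStep, Finset.Nat.sum_antidiagonal_eq_sum_range_succ (fun i j =>
        q ^ (i + 1).choose 2 * (qPoch q (-q) i * if i = 0 then 1 else 0) * qPochInv q j),
        Finset.sum_range_succ', Finset.sum_eq_zero (by simp)]
      simp [qPoch]
    · congr 2
      funext s
      rw [sq_eq_choose_two_add]
      ring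
  | succ m ih =>
    have hw : (fun i => parityWeight q 0 (i + 1)) = parityWeight q 0 := by
      funext i N; simp [parityWeight]
    have hw0 : parityWeight q 0 0 = fun i => q ^ (i + 1).choose 2 := by
      funext N; simp [parityWeight]
    rw [nestedSum, hw, hw0, ih]
    funext n
    rw [chainStep_choose_succ_baileySum_one hq]
    congr 2
    funext s
    ring

theorem nestedSum_parityWeight {q : ℂ} (hq : ‖q‖ < 1) (α : ℕ → ℂ) (m : ℕ) (h0 : α 0 = 1)
    (hs : ∀ s, α (s + 1) = (-1) ^ (s + 1) * q ^ (s + 1) ^ 2 *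
      (q ^ (m * (s + 2).choose 2) + q ^ (m * (s + 1).choose 2))) (r : ℕ) :
    nestedSum q (parityWeight q r) (m + 2 * r) = fun n => qPoch q (-q) n *
      baileySum q 0 (fun s => q ^ (r * s ^ 2) * α s) n := by
  induction r with
  | zero =>
    rw [mul_zero, add_zero, nestedSum_parityWeight_zero hq]
    funext n
    rw [baileySum_one_eq_baileySum_zero hq
      (fun s => (-1) ^ s * q ^ s ^ 2 * q ^ (m * (s + 1).choose 2)) α (by simp [h0])]
    · simp
    · intro s
      rw [hs]
      ring
  | succ r ih =>
    have hw : (fun i => parityWeight q (r + 1) (i + 1 + 1)) = parityWeight q r := by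
      funext i N
      have : ((i + 1 + 1) % 2 = 1 ∧ i + 1 + 1 < 2 * (r + 1)) ↔ (i % 2 = 1 ∧ i < 2 * r) := by omega
      simp only [parityWeight, this]
    have hw0 : parityWeight q (r + 1) 0 = fun i => q ^ (i + 1).choose 2 := by
      funext N; simp [parityWeight]
    have hw1 : parityWeight q (r + 1) (0 + 1) = fun i => q ^ i.choose 2 := by
      funext N; simp [parityWeight, show 1 < 2 * (r + 1) by omega]
    rw [show m + 2 * (r + 1) = m + 2 * r + 1 + 1 by ring, nestedSum, nestedSum, hw, hw0, hw1, ih,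
      funext (chainStep_choose_baileySum_zero hq _)]
    funext n
    rw [chainStep_choose_succ_baileySum_zero hq]
    congr 2
    funext s
    have h := one_add_pow_ne_zero hq s
    have e : (r + 1) * s ^ 2 = r * s ^ 2 + s.choose 2 + (s + 1).choose 2 := by
      rw [add_mul, one_mul, sq_eq_choose_two_add]; ring
    rw [e]
    field_simp
    ring

theorem Nsum_one (m : ℕ) (t : Fin m → ℕ) : Nsum m t 1 = ∑ j, t j := by
  simp [Nsum]

theorem Nsum_tail (m : ℕ) (t : Fin (m + 1) → ℕ) (i : ℕ) :
    Nsum (m + 1) t (i + 2) = Nsum m (Fin.tail t) (i + 1) := by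
  simp [Nsum, Fin.sum_univ_succ, Fin.tail]

/-- The summand `∏ w_i(N_{i+1}) / ∏ (q;q)_{n_j}` of an `m`-fold sum. -/
noncomputable def multiTerm (q : ℂ) (w : ℕ → ℕ → ℂ) (m : ℕ) (t : Fin m → ℕ) : ℂ :=
  (∏ i : Fin m, w i (Nsum m t (i + 1))) * ∏ j, qPochInv q (t j)

theorem multiTerm_succ (q : ℂ) (w : ℕ → ℕ → ℂ) (m : ℕ) (t : Fin (m + 1) → ℕ) :
    multiTerm q w (m + 1) t = w 0 (∑ j, t j) * qPochInv q (t 0) *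
      multiTerm q (fun i => w (i + 1)) m (Fin.tail t) := by
  simp only [multiTerm, Fin.prod_univ_succ, Fin.val_zero, Fin.val_succ, zero_add, Nsum_one,
    add_assoc, Nat.reduceAdd, Nsum_tail]
  simp only [Fin.tail]
  ring

theorem finite_setOf_sum_le (m n : ℕ) : {t : Fin m → ℕ | ∑ j, t j ≤ n}.Finite :=
  (Set.finite_Iic fun _ : Fin m => n).subset fun _ ht j =>
    (Finset.single_le_sum (fun _ _ => Nat.zero_le _) (Finset.mem_univ j)).trans ht

theorem nestedSum_eq_tsum (q : ℂ) (w : ℕ → ℕ → ℂ) (m n : ℕ) :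
    nestedSum q w m n = ∑' t : Fin m → ℕ,
      if ∑ j, t j ≤ n then qPochInv q (n - ∑ j, t j) * multiTerm q w m t else 0 := by
  induction m generalizing w n with
  | zero => simp [nestedSum, multiTerm]
  | succ m ih =>
    let g : ℕ × (Fin m → ℕ) → ℂ := fun p => if p.1 ≤ n then w 0 p.1 * qPochInv q (n - p.1) *
      (if ∑ j, p.2 j ≤ p.1 then qPochInv q (p.1 - ∑ j, p.2 j) *
        multiTerm q (fun i => w (i + 1)) m p.2 else 0) else 0
    let φ : (Fin (m + 1) → ℕ) → ℕ × (Fin m → ℕ) := fun t => (∑ j, t j, Fin.tail t)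
    have hφ : Function.Injective φ := by
      intro t u h
      obtain ⟨h1, h2⟩ := Prod.ext_iff.mp h
      simp only [φ, Fin.sum_univ_succ] at h1 h2
      have h3 : ∀ j : Fin m, t j.succ = u j.succ := fun j => congrFun h2 j
      simp only [h3, add_left_inj] at h1
      funext j
      exact Fin.cases h1 h3 j
    have hrange : Function.support g ⊆ Set.range φ := by
      rintro ⟨N, t⟩ h
      have hN : ∑ j, t j ≤ N := by
        by_contra hN
        exact h (by simp [g, hN])
      exact ⟨Fin.cons (N - ∑ j, t j) t, by simp [φ, Fin.sum_univ_succ, hN]⟩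
    have hsum : Summable g := by
      refine summable_of_hasFiniteSupport (((Set.finite_Iic n).prod
        (finite_setOf_sum_le m n)).subset ?_)
      rintro ⟨N, t⟩ h
      have hN : N ≤ n := by
        by_contra hN
        exact h (by simp [g, hN])
      have ht : ∑ j, t j ≤ N := by
        by_contra hN
        exact h (by simp [g, hN])
      exact ⟨hN, ht.trans hN⟩
    have hL : ∀ t : Fin (m + 1) → ℕ,
        (if ∑ j, t j ≤ n then qPochInv q (n - ∑ j, t j) * multiTerm q w (m + 1) t else 0) =
          g (φ t) := by
      intro t
      have h1 : ∑ j, Fin.tail t j ≤ ∑ j, t j := by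
        rw [Fin.sum_univ_succ t]; exact Nat.le_add_left _ _
      have h2 : ∑ j, t j - ∑ j, Fin.tail t j = t 0 := by
        rw [Fin.sum_univ_succ t]; exact Nat.add_sub_cancel _ _
      simp only [g, φ, h1, h2, if_true, multiTerm_succ]
      congr 1
      ring
    simp only [hL]
    rw [hφ.tsum_eq hrange, hsum.tsum_prod, tsum_eq_sum (s := range (n + 1)), nestedSum, chainStep,
      Finset.Nat.sum_antidiagonal_eq_sum_range_succ
        (fun i j => w 0 i * nestedSum q (fun i => w (i + 1)) m i * qPochInv q j)]
    · refine Finset.sum_congr rfl fun N hN => ?_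
      have hN' : N ≤ n := Nat.lt_succ_iff.mp (mem_range.mp hN)
      simp only [g, hN', if_true, tsum_mul_left, ← ih]
      ring
    · intro N hN
      have hN' : ¬ N ≤ n := fun h => hN (mem_range.mpr (Nat.lt_succ_of_le h))
      simp [g, hN']

/-! ### Limits -/

open Filter Topology

theorem summable_norm_neg_mul_pow {q : ℂ} (hq : ‖q‖ < 1) (x : ℂ) :
    Summable fun j : ℕ => ‖-(x * q ^ j)‖ := by
  simp only [norm_neg, norm_mul, norm_pow]
  exact (summable_geometric_of_lt_one (norm_nonneg _) hq).mul_left _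

theorem tendsto_qPoch {q : ℂ} (hq : ‖q‖ < 1) (x : ℂ) :
    Tendsto (qPoch q x) atTop (𝓝 (qPochInf q x)) := by
  have h := (multipliable_one_add_of_summable (summable_norm_neg_mul_pow hq x)).tendsto_prod_tprod_nat
  simp only [← sub_eq_add_neg] at h
  exact h

theorem qPochInf_ne_zero {q x : ℂ} (hq : ‖q‖ < 1) (hx : ‖x‖ < 1) : qPochInf q x ≠ 0 := by
  have h := tprod_one_add_ne_zero_of_summable (f := fun j : ℕ => -(x * q ^ j))
    (fun j => by
      rw [← sub_eq_add_neg]; exact one_sub_ne_zero_of_norm_lt (norm_mul_pow_lt hq hx j))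
    (summable_norm_neg_mul_pow hq x)
  simp only [← sub_eq_add_neg] at h
  exact h

theorem tendsto_qPochInv {q : ℂ} (hq : ‖q‖ < 1) :
    Tendsto (qPochInv q) atTop (𝓝 (qPochInf q q)⁻¹) :=
  (tendsto_qPoch hq q).inv₀ (qPochInf_ne_zero hq hq)

theorem exists_norm_qPochInv_le {q : ℂ} (hq : ‖q‖ < 1) :
    ∃ C : ℝ, 0 < C ∧ ∀ n, ‖qPochInv q n‖ ≤ C := by
  obtain ⟨C, hC⟩ := (tendsto_qPochInv hq).norm.bddAbove_range
  exact ⟨max C 1, by positivity, fun n => (hC ⟨n, rfl⟩).trans (le_max_left _ _)⟩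

theorem tendsto_baileySum_zero {q : ℂ} (hq : ‖q‖ < 1) {α : ℕ → ℂ}
    (hα : Summable fun s => ‖α s‖) :
    Tendsto (baileySum q 0 α) atTop (𝓝 ((∑' s, α s) * ((qPochInf q q)⁻¹ * (qPochInf q q)⁻¹))) := by
  obtain ⟨C, hC, hb⟩ := exists_norm_qPochInv_le hq
  have key : baileySum q 0 α = fun n => ∑' s, if s ≤ n then
      α s * (qPochInv q (n - s) * qPochInv q (n + s)) else 0 := by
    funext n
    rw [tsum_eq_sum (s := range (n + 1)), baileySum, Finset.Nat.sum_antidiagonal_eq_sum_range_succ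
        (fun s t => α s * qPochInv q t * qPochInv q (2 * s + t + 0))]
    · refine Finset.sum_congr rfl fun s hs => ?_
      have hs' : s ≤ n := Nat.lt_succ_iff.mp (mem_range.mp hs)
      rw [if_pos hs', show 2 * s + (n - s) + 0 = n + s by omega, mul_assoc]
    · intro s hs
      exact if_neg fun h => hs (mem_range.mpr (Nat.lt_succ_of_le h))
  rw [key, ← tsum_mul_right]
  refine tendsto_tsum_of_dominated_convergence (hα.mul_right (C * C)) (fun s => ?_)
    (Eventually.of_forall fun n s => ?_)
  · have h1 := (tendsto_qPochInv hq).comp (tendsto_sub_atTop_nat s)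
    have h2 := (tendsto_qPochInv hq).comp (tendsto_add_atTop_nat s)
    refine ((h1.mul h2).const_mul (α s)).congr' ?_
    filter_upwards [eventually_ge_atTop s] with n hn
    simp [hn]
  · split_ifs
    · rw [norm_mul, norm_mul]
      gcongr
      · exact hb _
      · exact hb _
    · rw [norm_zero]
      positivity

theorem summable_prod_pi {f : ℕ → ℝ} (hf : Summable f) (h0 : ∀ n, 0 ≤ f n) (m : ℕ) :
    Summable fun t : Fin m → ℕ => ∏ j, f (t j) := by
  induction m with
  | zero => exact (hasSum_fintype _).summable
  | succ m ih =>
    rw [← (Fin.consEquiv fun _ : Fin (m + 1) => ℕ).summable_iff]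
    refine (hf.mul_of_nonneg ih h0 fun t => Finset.prod_nonneg fun j _ => h0 _).congr fun p => ?_
    simp [Fin.prod_univ_succ, Fin.consEquiv]

theorem tendsto_nestedSum {q : ℂ} (hq : ‖q‖ < 1) {w : ℕ → ℕ → ℂ} {m : ℕ}
    (h : Summable (multiTerm q w m)) :
    Tendsto (nestedSum q w m) atTop (𝓝 ((qPochInf q q)⁻¹ * ∑' t, multiTerm q w m t)) := by
  obtain ⟨C, hC, hb⟩ := exists_norm_qPochInv_le hq
  rw [funext (nestedSum_eq_tsum q w m), ← tsum_mul_left]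
  refine tendsto_tsum_of_dominated_convergence (h.norm.mul_left C) (fun t => ?_)
    (Eventually.of_forall fun n t => ?_)
  · have h1 := (tendsto_qPochInv hq).comp (tendsto_sub_atTop_nat (∑ j, t j))
    refine (h1.mul_const (multiTerm q w m t)).congr' ?_
    filter_upwards [eventually_ge_atTop (∑ j, t j)] with n hn
    simp [hn]
  · split_ifs
    · rw [norm_mul]
      gcongr
      exact hb _
    · rw [norm_zero]
      positivity

/-! ### The Jacobi triple product -/

theorem sum_range_two_mul_succ (f : ℕ → ℂ) (n : ℕ) :
    ∑ i ∈ range (2 * n + 1), f i =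
      f n + ∑ s ∈ range n, (f (n + (s + 1)) + f (n - (s + 1))) := by
  rw [show 2 * n + 1 = n + (n + 1) by ring, Finset.sum_range_add, Finset.sum_range_succ',
    ← Finset.sum_range_reflect f n, Finset.sum_add_distrib, add_zero]
  simp only [add_comm 1, Nat.sub_sub]
  ring

theorem qPoch_div_pow {p z w : ℂ} (hp : p ≠ 0) (hzw : z * w = p) (n : ℕ) :
    qPoch p (z / p ^ n) n * p ^ (n + 1).choose 2 = (-z) ^ n * qPoch p w n := by
  induction n with
  | zero => simp [qPoch]
  | succ n ih =>
    have e : z / p ^ (n + 1) * p = z / p ^ n := by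
      rw [pow_succ]; field_simp
    rw [qPoch_succ', e, choose_two_succ (n + 1), pow_add, qPoch_succ p w, pow_succ (-z)]
    have e2 : (1 - z / p ^ (n + 1)) * p ^ (n + 1) = -z * (1 - w * p ^ n) := by
      rw [sub_mul, div_mul_cancel₀ _ (pow_ne_zero _ hp)]
      linear_combination -p ^ n * hzw
    linear_combination (-z * (1 - w * p ^ n)) * ih +
      qPoch p (z / p ^ n) n * p ^ (n + 1).choose 2 * e2

/-- A finite form of the Jacobi triple product. -/
theorem baileySum_jacobi {p z w : ℂ} (hp : ‖p‖ < 1) (hp0 : p ≠ 0) (hzw : z * w = p) {α : ℕ → ℂ}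
    (h0 : α 0 = 1)
    (hs : ∀ s, α (s + 1) = (-1) ^ (s + 1) * p ^ (s + 1).choose 2 * (z ^ (s + 1) + w ^ (s + 1)))
    (n : ℕ) : baileySum p 0 α n = qPoch p z n * qPoch p w n * qPochInv p (2 * n) := by
  have hz : z ≠ 0 := left_ne_zero_of_mul (hzw ▸ hp0)
  have hvand := sum_qChuVandermonde hp 0 (z / p ^ n) (2 * n)
  rw [Finset.Nat.sum_antidiagonal_eq_sum_range_succ (fun i j => (-(z / p ^ n)) ^ i *
    p ^ i.choose 2 * qPoch p 0 i * qPoch p (0 * (z / p ^ n) * p ^ i) j * qPochInv p i *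
      qPochInv p j), Nat.succ_eq_add_one, sum_range_two_mul_succ] at hvand
  have hone : ∀ i, qPoch p 0 i = 1 := fun i => by simp [qPoch]
  simp only [zero_mul, hone, mul_one] at hvand
  have hK : (-z) ^ n * p ^ n.choose 2 ≠ 0 :=
    mul_ne_zero (pow_ne_zero _ (neg_ne_zero.mpr hz)) (pow_ne_zero _ hp0)
  have hpn : p ^ n ≠ 0 := pow_ne_zero _ hp0
  have hup : ∀ s, (-(z / p ^ n)) ^ (n + s) * p ^ (n + s).choose 2 * (p ^ n) ^ n =
      (-z) ^ n * p ^ n.choose 2 * ((-z) ^ s * p ^ s.choose 2) := fun s => by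
    rw [choose_two_add, ← neg_div, div_pow, pow_add (p ^ n), pow_add p, pow_add p, pow_mul p n s,
      pow_add (-z)]
    field_simp
  have hdown : ∀ s ≤ n, (-(z / p ^ n)) ^ (n - s) * p ^ (n - s).choose 2 * (p ^ n) ^ n =
      (-z) ^ n * p ^ n.choose 2 * ((-w) ^ s * p ^ s.choose 2) := fun s hsn => by
    obtain ⟨u, rfl⟩ := Nat.exists_eq_add_of_le hsn
    rw [Nat.add_sub_cancel_left, choose_two_add, ← neg_div, div_pow, div_mul_eq_mul_div,
      div_mul_eq_mul_div, div_eq_iff (pow_ne_zero _ hpn)]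
    have e1 : (-z) ^ (s + u) * (-w) ^ s = (-z) ^ u * p ^ s := by
      rw [pow_add, mul_right_comm, ← mul_pow, neg_mul_neg, hzw, mul_comm]
    have e2 : s * s = s + 2 * s.choose 2 := by
      have := sq_eq_choose_two_add s
      rw [choose_two_succ] at this
      linarith
    have e3 : (p ^ (s + u)) ^ s = p ^ s * p ^ (2 * s.choose 2) * p ^ (s * u) := by
      rw [← pow_mul, add_mul, e2, mul_comm u s, pow_add, pow_add]
    rw [pow_add (p ^ (s + u)), e3, pow_add p, pow_add p]
    linear_combination -(p ^ s.choose 2 * p ^ u.choose 2 * p ^ (s * u) * p ^ s.choose 2 *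
      (p ^ (s + u)) ^ u) * e1
  have hprod : qPoch p (z / p ^ n) (2 * n) * (p ^ n) ^ n =
      (-z) ^ n * p ^ n.choose 2 * (qPoch p z n * qPoch p w n) := by
    rw [two_mul, qPoch_add, div_mul_cancel₀ _ hpn, ← pow_mul, ← sq, sq_eq_choose_two_add, pow_add]
    linear_combination qPoch p z n * p ^ n.choose 2 * qPoch_div_pow hp0 hzw n
  refine mul_left_cancel₀ hK ?_
  rw [← mul_assoc _ _ (qPochInv p _), ← hprod, mul_right_comm (qPoch p _ _), ← hvand, baileySum,
    Finset.Nat.sum_antidiagonal_eq_sum_range_succ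
      (fun s t => α s * qPochInv p t * qPochInv p (2 * s + t + 0)), Finset.sum_range_succ', h0,
    mul_add, add_mul, add_comm, Finset.mul_sum, Finset.sum_mul]
  congr 1
  · have := hup 0
    simp only [add_zero, pow_zero, Nat.choose_zero_succ, mul_one, mul_zero, zero_add, one_mul,
      Nat.sub_zero] at this ⊢
    rw [show 2 * n - n = n by omega]
    linear_combination -(qPochInv p n * qPochInv p n) * this
  · refine Finset.sum_congr rfl fun s hsn => ?_
    have hsn' := mem_range.mp hsn
    have hu := hup (s + 1)
    have hd := hdown (s + 1) hsn'
    rw [hs, show 2 * n - (n + (s + 1)) = n - (s + 1) by omega,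
      show 2 * n - (n - (s + 1)) = n + (s + 1) by omega,
      show 2 * (s + 1) + (n - (s + 1)) + 0 = n + (s + 1) by omega]
    rw [neg_pow z (s + 1)] at hu
    rw [neg_pow w (s + 1)] at hd
    linear_combination -(qPochInv p (n - (s + 1)) * qPochInv p (n + (s + 1))) * (hu + hd)

/-- The Jacobi triple product, with the two halves of the theta series folded together. -/
theorem tsum_jacobi {p z w : ℂ} (hp : ‖p‖ < 1) (hzw : z * w = p) {α : ℕ → ℂ} (h0 : α 0 = 1)
    (hs : ∀ s, α (s + 1) = (-1) ^ (s + 1) * p ^ (s + 1).choose 2 * (z ^ (s + 1) + w ^ (s + 1)))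
    (hα : Summable fun s => ‖α s‖) :
    ∑' s, α s = qPochInf p z * qPochInf p w * qPochInf p p := by
  by_cases hp0 : p = 0
  · subst hp0
    have hinf : ∀ x : ℂ, qPochInf 0 x = 1 - x := fun x => by
      rw [qPochInf, tprod_eq_mulSingle 0]
      · simp
      · intro j hj
        simp [hj]
    rw [tsum_eq_sum (s := range 2), Finset.sum_range_succ, Finset.sum_range_one, h0, hs, hinf,
      hinf, hinf]
    · simp
      linear_combination -hzw
    · intro s hs2
      obtain ⟨s, rfl⟩ : ∃ u, s = u + 2 := ⟨s - 2, by simp at hs2; omega⟩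
      rw [hs, choose_two_succ, zero_pow (by omega)]
      simp
  · have h1 := tendsto_baileySum_zero hp hα
    have h2 := ((tendsto_qPoch hp z).mul (tendsto_qPoch hp w)).mul
      ((tendsto_qPochInv hp).comp (tendsto_id.const_mul_atTop' (zero_lt_two (α := ℕ))))
    have h3 := tendsto_nhds_unique h1 (h2.congr fun n => (baileySum_jacobi hp hp0 hzw h0 hs n).symm)
    have h4 := qPochInf_ne_zero hp hp
    field_simp at h3
    rw [h3]
    ring

/-! ### The multisum -/

/-- The exponent of `q` contributed by the `(i+1)`-st partial sum `N`. -/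
def parityExponent (r i N : ℕ) : ℕ :=
  if i % 2 = 1 ∧ i < 2 * r then N ^ 2 - N else N ^ 2 + N

theorem parityWeight_sq (q : ℂ) (r i N : ℕ) :
    parityWeight (q ^ 2) r i N = q ^ parityExponent r i N := by
  have h := sq_eq_choose_two_add N
  have h' := choose_two_succ N
  unfold parityWeight parityExponent
  split_ifs
  · rw [← pow_mul]
    congr 1
    omega
  · rw [← pow_mul]
    congr 1
    omega

theorem sum_parityExponent_range_two_mul {N : ℕ → ℕ} (hN : ∀ i, N (i + 1) ≤ N i) (r : ℕ) {R : ℕ}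
    (hR : r ≤ R) :
    ∑ i ∈ range (2 * r), parityExponent R i (N (i + 1)) =
      (∑ i ∈ range (2 * r), N (i + 1) ^ 2) +
        ∑ j ∈ range r, (N (2 * j + 1) - N (2 * j + 1 + 1)) := by
  induction r with
  | zero => simp
  | succ r ih =>
    have h1 : parityExponent R (2 * r) (N (2 * r + 1)) = N (2 * r + 1) ^ 2 + N (2 * r + 1) :=
      if_neg (by omega)
    have h2 : parityExponent R (2 * r + 1) (N (2 * r + 1 + 1)) =
        N (2 * r + 1 + 1) ^ 2 - N (2 * r + 1 + 1) := if_pos (by omega)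
    have h3 := hN (2 * r + 1)
    have h4 : N (2 * r + 1 + 1) ≤ N (2 * r + 1 + 1) ^ 2 := Nat.le_self_pow two_ne_zero _
    rw [show 2 * (r + 1) = 2 * r + 1 + 1 by ring, Finset.sum_range_succ, Finset.sum_range_succ,
      ih (by omega), Finset.sum_range_succ (fun i => N (i + 1) ^ 2),
      Finset.sum_range_succ (fun i => N (i + 1) ^ 2), Finset.sum_range_succ _ r, h1, h2]
    omega

theorem sum_parityExponent {N : ℕ → ℕ} (hN : ∀ i, N (i + 1) ≤ N i) (r m : ℕ) :
    (∑ i ∈ Finset.Icc 1 (m + 2 * r), N i ^ 2) +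
        (∑ i ∈ (Finset.Icc 1 (2 * r + 1 - 2)).filter (fun i => i % 2 = 1), (N i - N (i + 1))) +
        ∑ i ∈ Finset.Icc (2 * r + 1) (m + 2 * r), N i =
      ∑ i ∈ range (m + 2 * r), parityExponent r i (N (i + 1)) := by
  have e1 : ∑ i ∈ Finset.Icc 1 (m + 2 * r), N i ^ 2 = ∑ i ∈ range (2 * r + m), N (i + 1) ^ 2 := by
    refine Finset.sum_nbij' (· - 1) (· + 1) ?_ ?_ ?_ ?_ ?_ <;> intro i hi <;>
      simp only [mem_Icc, mem_range] at hi ⊢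
    · omega
    · omega
    · omega
    · omega
    · rw [Nat.sub_add_cancel hi.1]
  have e2 : ∑ i ∈ (Finset.Icc 1 (2 * r + 1 - 2)).filter (fun i => i % 2 = 1), (N i - N (i + 1)) =
      ∑ j ∈ range r, (N (2 * j + 1) - N (2 * j + 1 + 1)) := by
    refine Finset.sum_nbij' (· / 2) (2 * · + 1) ?_ ?_ ?_ ?_ ?_ <;> intro i hi <;>
      simp only [mem_Icc, mem_range, mem_filter] at hi ⊢
    · omega
    · omega
    · omega
    · omega
    · rw [show 2 * (i / 2) + 1 = i by omega]
  have e3 : ∑ i ∈ Finset.Icc (2 * r + 1) (m + 2 * r), N i =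
      ∑ i ∈ range m, N (2 * r + i + 1) := by
    refine Finset.sum_nbij' (· - (2 * r + 1)) (2 * r + · + 1) ?_ ?_ ?_ ?_ ?_ <;> intro i hi <;>
      simp only [mem_Icc, mem_range] at hi ⊢
    · omega
    · omega
    · omega
    · omega
    · rw [show 2 * r + (i - (2 * r + 1)) + 1 = i by omega]
  have e4 : ∀ i, parityExponent r (2 * r + i) (N (2 * r + i + 1)) =
      N (2 * r + i + 1) ^ 2 + N (2 * r + i + 1) := fun i => if_neg (by omega)
  rw [e1, e2, e3, add_comm m, Finset.sum_range_add, Finset.sum_range_add,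
    sum_parityExponent_range_two_mul hN r le_rfl]
  simp only [e4, Finset.sum_add_distrib]
  ring

theorem Nsum_succ_le (m : ℕ) (n : Fin m → ℕ) (i : ℕ) : Nsum m n (i + 1) ≤ Nsum m n i := by
  refine Finset.sum_le_sum fun j _ => ?_
  split_ifs
  all_goals omega

theorem owTerm_eq_multiTerm (q : ℂ) (m r : ℕ) :
    owTerm (m + 2 * r + 1) (2 * r + 1) q =
      multiTerm (q ^ 2) (parityWeight (q ^ 2) r) (m + 2 * r) := by
  funext n
  have hE := sum_parityExponent (Nsum_succ_le (m + 2 * r) n) r m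
  rw [multiTerm]
  simp only [parityWeight_sq]
  rw [Finset.prod_pow_eq_pow_sum,
    Fin.sum_univ_eq_sum_range (fun i => parityExponent r i (Nsum (m + 2 * r) n (i + 1))), ← hE,
    owTerm, div_eq_mul_inv, ← Finset.prod_inv_distrib]
  rfl

theorem summable_owTerm {k a : ℕ} (hk : 2 ≤ k) {q : ℂ} (hq : ‖q‖ < 1) :
    Summable (owTerm k a q) := by
  have hq2 : ‖q ^ 2‖ < 1 := by
    rw [norm_pow]; exact pow_lt_one₀ (norm_nonneg _) hq two_ne_zero
  obtain ⟨C, hC, hb⟩ := exists_norm_qPochInv_le hq2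
  refine Summable.of_norm_bounded (summable_prod_pi
    ((summable_geometric_of_lt_one (norm_nonneg _) hq).mul_left C) (fun n => by positivity)
      (k - 1)) fun n => ?_
  rw [owTerm, div_eq_mul_inv, ← Finset.prod_inv_distrib, norm_mul, norm_pow, norm_prod,
    Finset.prod_mul_distrib, mul_comm, Finset.prod_pow_eq_pow_sum]
  refine mul_le_mul (Finset.prod_le_prod (fun _ _ => norm_nonneg _) fun j _ => hb _)
    (pow_le_pow_of_le_one (norm_nonneg _) hq.le ?_) (by positivity)
    (Finset.prod_nonneg fun _ _ => hC.le)
  have h1 : Nsum (k - 1) n 1 ^ 2 ≤ ∑ i ∈ Finset.Icc 1 (k - 1), Nsum (k - 1) n i ^ 2 :=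
    Finset.single_le_sum (f := fun i => Nsum (k - 1) n i ^ 2) (fun _ _ => Nat.zero_le _)
      (mem_Icc.mpr ⟨le_rfl, by omega⟩)
  have h2 : Nsum (k - 1) n 1 ≤ Nsum (k - 1) n 1 ^ 2 := Nat.le_self_pow two_ne_zero _
  rw [← Nsum_one]
  omega

theorem tsum_multiTerm_parityWeight {q : ℂ} (hq : ‖q‖ < 1) {m r : ℕ}
    (hsum : Summable (multiTerm (q ^ 2) (parityWeight (q ^ 2) r) (m + 2 * r))) :
    ∑' t, multiTerm (q ^ 2) (parityWeight (q ^ 2) r) (m + 2 * r) t =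
      qPochInf (q ^ 2) (-(q ^ 2)) * (qPochInf (q ^ 2) (q ^ 2))⁻¹ *
        (qPochInf (q ^ (2 * m + 4 * r + 4)) (q ^ (2 * m + 2 * r + 2)) *
          qPochInf (q ^ (2 * m + 4 * r + 4)) (q ^ (2 * r + 2)) *
          qPochInf (q ^ (2 * m + 4 * r + 4)) (q ^ (2 * m + 4 * r + 4))) := by
  have hpow : ∀ n ≠ 0, ‖q ^ n‖ < 1 := fun n hn => by
    rw [norm_pow]; exact pow_lt_one₀ (norm_nonneg _) hq hn
  have hq2 := hpow 2 two_ne_zero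
  let α : ℕ → ℂ := fun s => if s = 0 then 1 else (-1) ^ s * (q ^ 2) ^ s ^ 2 *
    ((q ^ 2) ^ (m * (s + 1).choose 2) + (q ^ 2) ^ (m * s.choose 2))
  let β : ℕ → ℂ := fun s => (q ^ 2) ^ (r * s ^ 2) * α s
  have hβs : ∀ s, β (s + 1) = (-1) ^ (s + 1) * (q ^ (2 * m + 4 * r + 4)) ^ (s + 1).choose 2 *
      ((q ^ (2 * m + 2 * r + 2)) ^ (s + 1) + (q ^ (2 * r + 2)) ^ (s + 1)) := fun s => by
    simp only [β, α, if_neg s.succ_ne_zero]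
    generalize s + 1 = u
    rw [sq_eq_choose_two_add, choose_two_succ]
    ring
  have hle : ∀ n, ‖(q ^ 2) ^ n‖ ≤ 1 := fun n => by
    rw [norm_pow]; exact pow_le_one₀ (norm_nonneg _) hq2.le
  have hβsum : Summable fun s => ‖β s‖ := by
    refine Summable.of_nonneg_of_le (fun _ => norm_nonneg _) (fun s => ?_)
      ((summable_geometric_of_lt_one (norm_nonneg _) hq2).mul_right 2)
    have hα : ‖α s‖ ≤ ‖q ^ 2‖ ^ s * 2 := by
      simp only [α]
      split_ifs with h
      · simp [h]
      · rw [norm_mul, norm_mul, norm_pow, norm_neg, norm_one, one_pow, one_mul, norm_pow (q ^ 2)]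
        have h1 := (norm_add_le ((q ^ 2) ^ (m * (s + 1).choose 2)) ((q ^ 2) ^ (m * s.choose 2))).trans
          (add_le_add (hle _) (hle _))
        rw [one_add_one_eq_two] at h1
        exact mul_le_mul (pow_le_pow_of_le_one (norm_nonneg _) hq2.le
          (Nat.le_self_pow two_ne_zero _)) h1 (norm_nonneg _) (by positivity)
    rw [norm_mul]
    exact (mul_le_of_le_one_left (norm_nonneg _) (hle _)).trans hα
  have hjac := tsum_jacobi (hpow (2 * m + 4 * r + 4) (by omega))
    (z := q ^ (2 * m + 2 * r + 2)) (w := q ^ (2 * r + 2)) (by ring) (α := β) (by simp [β, α])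
    hβs hβsum
  have h1 := tendsto_nestedSum hq2 hsum
  have h2 := (tendsto_qPoch hq2 (-(q ^ 2))).mul (tendsto_baileySum_zero hq2 hβsum)
  rw [nestedSum_parityWeight hq2 α m (by simp [α]) (fun s => by simp [α]) r] at h1
  have h3 := tendsto_nhds_unique h1 h2
  have h4 := qPochInf_ne_zero hq2 hq2
  rw [← hjac]
  refine mul_left_cancel₀ (inv_ne_zero h4) ?_
  rw [h3]
  ring


/-- Kim–Yee's product formula for the multisum when `k` is even and `a` is odd. -/
theorem OW_product_k_even_a_odd (k a : ℕ) (ha : 1 ≤ a) (hak : a ≤ k)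
    (hk : Even k) (haodd : Odd a) (q : ℂ) (hq : ‖q‖ < 1) :
    Summable (owTerm k a q) ∧
    ∑' n : Fin (k - 1) → ℕ, owTerm k a q n =
      qPochInf (q ^ 2) (-(q ^ 2)) * qPochInf (q ^ (2 * k + 2)) (q ^ (a + 1)) *
        qPochInf (q ^ (2 * k + 2)) (q ^ (2 * k + 1 - a)) *
        qPochInf (q ^ (2 * k + 2)) (q ^ (2 * k + 2)) / qPochInf (q ^ 2) (q ^ 2) := by
  have hk2 : 2 ≤ k := by
    obtain ⟨c, rfl⟩ := hk
    omega
  have hsum : Summable (owTerm k a q) := summable_owTerm hk2 hq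
  refine ⟨hsum, ?_⟩
  obtain ⟨r, rfl⟩ := haodd
  obtain ⟨m, rfl⟩ : ∃ m, k = m + 2 * r + 1 := ⟨k - (2 * r + 1), by omega⟩
  rw [owTerm_eq_multiTerm] at hsum ⊢
  have h := tsum_multiTerm_parityWeight hq hsum
  rw [show 2 * (m + 2 * r + 1) + 2 = 2 * m + 4 * r + 4 by ring,
    show 2 * (m + 2 * r + 1) + 1 - (2 * r + 1) = 2 * m + 2 * r + 2 by omega,
    show 2 * r + 1 + 1 = 2 * r + 2 by ring]
  refine h.trans ?_
  ring
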